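/- Fix β > 0 and for σ > 0 define the probability measure ν_σ(dx) = exp{−(2/σ²)(x⁴/4 − x²/2 + (β/2)x²)}dx / ∫exp{−(2/σ²)(y⁴/4 − y²/2 + (β/2)y²)}dy on ℝ. Then ν_σ solves the Dawson equation for every σ > 0. Moreover, if there exists σ0 > 0 with 1 = (2β/σ0²)∫x²ν_{σ0}(dx), then σ0 ∈ [√(2β/3), √(2β)], and σ0 is a bifurcation point: for every δ′ > 0 there exist σ ∈ (σ0−δ′, σ0+δ′) and a probability measure μ_σ ≠ ν_σ on ℝ satisfying the Dawson equation at parameter σ. -/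

import Mathlib

open MeasureTheory Real Set Filter Topology ENNReal NNReal

noncomputable section

namespace PME

def gibbs {α : Type*} [MeasurableSpace α] (U : α → ℝ) (m : Measure α) : Measure α :=
  (ENNReal.ofReal (∫ x, Real.exp (-(U x)) ∂m))⁻¹ •
    m.withDensity (fun x => ENNReal.ofReal (Real.exp (-(U x))))

/-- The Dawson fixed-point equation at parameters `β, σ`. -/
def dawsonSol (β σ : ℝ) (ν : Measure ℝ) : Prop :=
  IsProbabilityMeasure ν ∧ Integrable (fun z : ℝ => z ^ 2) ν ∧
  ν = gibbs (fun x : ℝ =>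
      (2 / σ ^ 2) * (x ^ 4 / 4 - x ^ 2 / 2) + (β / σ ^ 2) * ∫ z, (x - z) ^ 2 ∂ν) volume

/-- The explicit symmetric stationary measure `ν_σ`. -/
def nuSigma (β σ : ℝ) : Measure ℝ :=
  gibbs (fun x : ℝ => (2 / σ ^ 2) * (x ^ 4 / 4 - x ^ 2 / 2 + (β / 2) * x ^ 2)) volume

/-- Quadratic coercivity of the potential. -/
def Coer (a b : ℝ) : Prop := ∃ c > 0, ∃ C : ℝ, ∀ x : ℝ, c * x ^ 2 - C ≤ a * x ^ 4 + b * x ^ 2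

/-- Unnormalised weight. -/
def wt (a b h x : ℝ) : ℝ := Real.exp (-(a * x ^ 4 + b * x ^ 2) + h * x)

/-- Unnormalised moments. -/
def mom (a b h : ℝ) (n : ℕ) : ℝ := ∫ x, x ^ n * wt a b h x

lemma coer_quartic {a : ℝ} (ha : 0 < a) (b : ℝ) : Coer a b := by
  refine ⟨1, one_pos, (1 - b) ^ 2 / (4 * a), fun x => ?_⟩
  have : 0 ≤ (2 * a * x ^ 2 - (1 - b)) ^ 2 / (4 * a) := by positivity
  have e : (2 * a * x ^ 2 - (1 - b)) ^ 2 / (4 * a)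
      = a * x ^ 4 - (1 - b) * x ^ 2 + (1 - b) ^ 2 / (4 * a) := by
    field_simp
    ring
  linarith

lemma coer_gauss {b : ℝ} (hb : 0 < b) : Coer 0 b :=
  ⟨b, hb, 0, fun x => by simp⟩

lemma wt_cont (a b h : ℝ) : Continuous (wt a b h) := by
  unfold wt; fun_prop

lemma wt_pos (a b h x : ℝ) : 0 < wt a b h x := Real.exp_pos _

lemma dom_integrable {a b : ℝ} (hc : Coer a b) (H : ℝ) (n : ℕ) :
    Integrable (fun x : ℝ => |x| ^ n * (Real.exp (H * |x|) * wt a b 0 x)) := by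
  obtain ⟨c, hc0, C, hC⟩ := hc
  have hg : Integrable (fun x : ℝ => Real.exp (C + (n + H) ^ 2 / (2 * c)) * Real.exp (-(c / 2) * x ^ 2)) :=
    (integrable_exp_neg_mul_sq (by positivity)).const_mul _
  refine hg.mono' ?_ (ae_of_all _ fun x => ?_)
  · refine Continuous.aestronglyMeasurable ?_
    have := wt_cont a b 0
    fun_prop
  · rw [Real.norm_of_nonneg (by have := (wt_pos a b 0 x).le; positivity)]
    have h1 : |x| ^ n ≤ Real.exp (n * |x|) := by
      rw [Real.exp_nat_mul]
      have := Real.add_one_le_exp |x|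
      exact pow_le_pow_left₀ (abs_nonneg _) (by linarith) n
    calc |x| ^ n * (Real.exp (H * |x|) * wt a b 0 x)
        ≤ Real.exp (n * |x|) * (Real.exp (H * |x|) * wt a b 0 x) := by
          have := (wt_pos a b 0 x).le
          gcongr
      _ ≤ _ := by
          unfold wt
          rw [← Real.exp_add, ← Real.exp_add, ← Real.exp_add]
          apply Real.exp_le_exp.2
          have h2 := hC x
          have h3 : 0 ≤ (c * |x| - (n + H)) ^ 2 / (2 * c) := by positivity
          have e : (c * |x| - (n + H)) ^ 2 / (2 * c)
              = c / 2 * x ^ 2 - (n + H) * |x| + (n + H) ^ 2 / (2 * c) := by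
            rw [← sq_abs x]
            field_simp
            ring
          linarith

lemma mom_integrable {a b : ℝ} (hc : Coer a b) (h : ℝ) (n : ℕ) :
    Integrable (fun x : ℝ => x ^ n * wt a b h x) := by
  refine (dom_integrable hc |h| n).mono' ?_ (ae_of_all _ fun x => ?_)
  · refine Continuous.aestronglyMeasurable ?_
    have := wt_cont a b h
    fun_prop
  · rw [norm_mul, norm_pow, Real.norm_eq_abs, Real.norm_of_nonneg (wt_pos a b h x).le]
    gcongr
    unfold wt
    rw [← Real.exp_add]
    apply Real.exp_le_exp.2
    have : h * x ≤ |h| * |x| := by rw [← abs_mul]; exact le_abs_self _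
    linarith

lemma mom0_pos {a b : ℝ} (hc : Coer a b) (h : ℝ) : 0 < mom a b h 0 := by
  unfold mom
  have := mom_integrable hc h 0
  simp only [pow_zero, one_mul] at this ⊢
  exact integral_exp_pos this

lemma cont_int_pos {f : ℝ → ℝ} (hf : Continuous f) (hi : Integrable f) (h0 : ∀ x, 0 ≤ f x)
    {y : ℝ} (hy : f y ≠ 0) : 0 < ∫ x, f x := by
  rw [integral_pos_iff_support_of_nonneg h0 hi]
  exact (hf.isOpen_support).measure_pos _ ⟨y, hy⟩

lemma ibp {a b : ℝ} (hc : Coer a b) (h : ℝ) (n : ℕ) :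
    n * mom a b h (n - 1) - 4 * a * mom a b h (n + 3) - 2 * b * mom a b h (n + 1)
      + h * mom a b h n = 0 := by
  have i1 := (mom_integrable hc h (n-1)).const_mul (n : ℝ)
  have i2 := (mom_integrable hc h (n+3)).const_mul (4 * a)
  have i3 := (mom_integrable hc h (n+1)).const_mul (2 * b)
  have i4 := (mom_integrable hc h n).const_mul h
  have hi := ((i1.sub i2).sub i3).add i4
  have hd : ∀ x : ℝ, HasDerivAt (fun x : ℝ => x ^ n * wt a b h x)
      (n * (x ^ (n-1) * wt a b h x) - 4 * a * (x ^ (n+3) * wt a b h x)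
        - 2 * b * (x ^ (n+1) * wt a b h x) + h * (x ^ n * wt a b h x)) x := by
    intro x
    have hE : HasDerivAt (fun x : ℝ => -(a * x ^ 4 + b * x ^ 2) + h * x)
        (-(a * (4 * x ^ 3) + b * (2 * x)) + h) x := by
      have h4 := (hasDerivAt_pow 4 x).const_mul a
      have h2 := (hasDerivAt_pow 2 x).const_mul b
      have h1 := (hasDerivAt_id x).const_mul h
      exact ((h4.add h2).neg.add h1).congr_deriv (by norm_num)
    refine ((hasDerivAt_pow n x).mul hE.exp).congr_deriv ?_
    unfold wt
    ring
  have := integral_eq_zero_of_hasDerivAt_of_integrable hd hi (mom_integrable hc h n)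
  have e1 := integral_add ((i1.sub i2).sub i3) i4
  have e2 := integral_sub (i1.sub i2) i3
  have e3 := integral_sub i1 i2
  simp only [Pi.sub_apply, integral_const_mul] at e1 e2 e3
  rw [this] at e1
  unfold mom
  linarith

lemma mom_odd (a b : ℝ) {n : ℕ} (hn : Odd n) : mom a b 0 n = 0 := by
  have := integral_neg_eq_self (fun x : ℝ => x ^ n * wt a b 0 x) volume
  have e : ∀ x : ℝ, (-x) ^ n * wt a b 0 (-x) = - (x ^ n * wt a b 0 x) := by
    intro x
    unfold wt
    rw [hn.neg_pow, Even.neg_pow (by decide), Even.neg_pow (by decide)]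
    simp
  simp only [e, integral_neg] at this
  unfold mom
  linarith

/-- scaling -/
lemma mom_scale (a b : ℝ) {l : ℝ} (hl : 0 < l) (n : ℕ) :
    mom (l ^ 4 * a) (l ^ 2 * b) 0 n * l ^ (n + 1) = mom a b 0 n := by
  have := Measure.integral_comp_mul_left (fun x : ℝ => x ^ n * wt a b 0 x) l
  have e : ∀ x : ℝ, (l * x) ^ n * wt a b 0 (l * x) = l ^ n * (x ^ n * wt (l ^ 4 * a) (l ^ 2 * b) 0 x) := by
    intro x
    unfold wt
    rw [mul_pow, mul_assoc]
    congr 3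
    ring
  simp only [e, integral_const_mul, smul_eq_mul] at this
  unfold mom
  rw [abs_of_pos (by positivity)] at this
  have h2 : ∫ x, x ^ n * wt a b 0 x = l * (l⁻¹ * ∫ x, x ^ n * wt a b 0 x) := by field_simp
  rw [h2, ← this]
  ring

lemma upper {a b : ℝ} (hc : Coer a b) :
    mom a b 0 2 ^ 2 ≤ mom a b 0 4 * mom a b 0 0 := by
  have h0 := mom0_pos hc 0
  set M := mom a b 0 2 / mom a b 0 0 with hM
  have i1 := mom_integrable hc 0 4
  have i2 := (mom_integrable hc 0 2).const_mul (2 * M)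
  have i3 := (mom_integrable hc 0 0).const_mul (M ^ 2)
  have e1 := integral_add (i1.sub i2) i3
  have e2 := integral_sub i1 i2
  simp only [Pi.sub_apply, integral_const_mul] at e1 e2
  have hp : 0 ≤ ∫ x, (x ^ 4 * wt a b 0 x - 2 * M * (x ^ 2 * wt a b 0 x) + M ^ 2 * (x ^ 0 * wt a b 0 x)) := by
    refine integral_nonneg fun x => ?_
    have : 0 ≤ (x ^ 2 - M) ^ 2 * wt a b 0 x := mul_nonneg (sq_nonneg _) (wt_pos _ _ _ _).le
    simp only [Pi.zero_apply]
    nlinarith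
  have h : 0 ≤ mom a b 0 4 - 2 * M * mom a b 0 2 + M ^ 2 * mom a b 0 0 := by
    unfold mom at *; linarith
  have e : M * mom a b 0 0 = mom a b 0 2 := by rw [hM]; field_simp
  have h' : 0 ≤ mom a b 0 4 - M * mom a b 0 2 := by
    have e' : M ^ 2 * mom a b 0 0 = M * mom a b 0 2 := by rw [← e]; ring
    linarith
  have := mul_nonneg h' h0.le
  have e'' : M * mom a b 0 2 * mom a b 0 0 = mom a b 0 2 ^ 2 := by
    rw [mul_right_comm, e]; ring
  linarith

lemma lower {a b : ℝ} (ha : 0 < a) :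
    mom a b 0 4 * mom a b 0 0 ≤ 3 * mom a b 0 2 ^ 2 := by
  have hc := coer_quartic ha b
  have h0 := mom0_pos hc 0
  have h2 : 0 < mom a b 0 2 := by
    refine cont_int_pos (y := 1) (by have := wt_cont a b 0; fun_prop) (mom_integrable hc 0 2) (fun x => ?_) ?_
    · have := (wt_pos a b 0 x).le; positivity
    · have := (wt_pos a b 0 1).ne'; simpa
  set Z := mom a b 0 0 with hZ
  set M := mom a b 0 2 / Z with hM
  have hMp : 0 < M := by positivity
  set k := 1 / (2 * M) with hk
  have hkp : 0 < k := by positivity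
  have hg := coer_gauss hkp
  have hq0 := mom0_pos hg 0
  set Q := mom 0 k 0 0 with hQ
  have g1 := ibp hg 0 1
  have g3 := ibp hg 0 3
  norm_num at g1 g3
  rw [← hQ] at g1
  have hkM : 2 * k * M = 1 := by rw [hk]; field_simp
  have q2 : mom 0 k 0 2 = M * Q := by nlinarith
  have q4 : mom 0 k 0 4 = 3 * M ^ 2 * Q := by nlinarith
  -- normalised log densities
  set d := - Real.log Z + Real.log Q with hd
  have key : 0 ≤ ∫ x, ((-a) * (Z⁻¹ * (x ^ 4 * wt a b 0 x) - Q⁻¹ * (x ^ 4 * wt 0 k 0 x)) +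
      (k - b) * (Z⁻¹ * (x ^ 2 * wt a b 0 x) - Q⁻¹ * (x ^ 2 * wt 0 k 0 x)) +
      d * (Z⁻¹ * (x ^ 0 * wt a b 0 x) - Q⁻¹ * (x ^ 0 * wt 0 k 0 x))) := by
    refine integral_nonneg fun x => ?_
    simp only [Pi.zero_apply]
    set A := - Real.log Z + -(a * x ^ 4 + b * x ^ 2) with hA
    set B := - Real.log Q + -(k * x ^ 2) with hB
    have eA : Z⁻¹ * wt a b 0 x = Real.exp A := by
      rw [hA, Real.exp_add, Real.exp_neg, Real.exp_log h0]; unfold wt; simp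
    have eB : Q⁻¹ * wt 0 k 0 x = Real.exp B := by
      rw [hB, Real.exp_add, Real.exp_neg, Real.exp_log hq0]; unfold wt; simp
    have : (A - B) * (Real.exp A - Real.exp B) ≥ 0 := by
      rcases le_total A B with h | h
      · have := Real.exp_le_exp.2 h; nlinarith
      · have := Real.exp_le_exp.2 h; nlinarith
    rw [← eA, ← eB] at this
    have e : A - B = -a * x ^ 4 + (k - b) * x ^ 2 + d := by rw [hA, hB, hd]; ring
    rw [e] at this
    linarith
  have ip := fun n => (mom_integrable hc 0 n).const_mul Z⁻¹
  have iq := fun n => (mom_integrable hg 0 n).const_mul Q⁻¹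
  have id := fun n => (ip n).sub (iq n)
  have es := fun n => integral_sub (ip n) (iq n)
  simp only [integral_const_mul] at es
  have e1 := integral_add (((id 4).const_mul (-a)).add ((id 2).const_mul (k - b))) ((id 0).const_mul d)
  have e2 := integral_add ((id 4).const_mul (-a)) ((id 2).const_mul (k - b))
  simp only [Pi.sub_apply, Pi.add_apply, integral_const_mul, es] at e1 e2
  rw [e1, e2] at key
  change 0 ≤ -a * (Z⁻¹ * mom a b 0 4 - Q⁻¹ * mom 0 k 0 4) + (k - b) * (Z⁻¹ * mom a b 0 2 - Q⁻¹ * mom 0 k 0 2)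
    + d * (Z⁻¹ * Z - Q⁻¹ * Q) at key
  rw [q2, q4] at key
  have z1 : Z⁻¹ * mom a b 0 2 - Q⁻¹ * (M * Q) = 0 := by rw [hM]; field_simp; ring
  have z2 : Z⁻¹ * Z - Q⁻¹ * Q = 0 := by field_simp; ring
  have z3 : Q⁻¹ * (3 * M ^ 2 * Q) = 3 * M ^ 2 := by field_simp
  rw [z1, z2, z3] at key
  have : Z⁻¹ * mom a b 0 4 ≤ 3 * M ^ 2 := by nlinarith
  have e5 : Z⁻¹ * mom a b 0 4 = mom a b 0 4 * Z / Z ^ 2 := by field_simp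
  have e6 : 3 * M ^ 2 = 3 * mom a b 0 2 ^ 2 / Z ^ 2 := by rw [hM]; field_simp
  rw [e5, e6] at this
  exact (div_le_div_iff_of_pos_right (by positivity)).1 this

lemma wt_shift (a b₁ b₂ x : ℝ) :
    wt a b₂ 0 x = wt a b₁ 0 x * Real.exp (-((b₂ - b₁) * x ^ 2)) := by
  unfold wt
  rw [← Real.exp_add]
  congr 1
  ring

lemma split4 {a b₁ b₂ : ℝ} (hc₁ : Coer a b₁) (hc₂ : Coer a b₂) (n : ℕ) (t e : ℝ) :
    Integrable (fun x : ℝ => (x ^ n - t) * (e * wt a b₁ 0 x - wt a b₂ 0 x)) ∧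
    ∫ x, (x ^ n - t) * (e * wt a b₁ 0 x - wt a b₂ 0 x) =
      e * (mom a b₁ 0 n - t * mom a b₁ 0 0) - (mom a b₂ 0 n - t * mom a b₂ 0 0) := by
  have i1 := ((mom_integrable hc₁ 0 n).sub ((mom_integrable hc₁ 0 0).const_mul t)).const_mul e
  have i2 := ((mom_integrable hc₂ 0 n).sub ((mom_integrable hc₂ 0 0).const_mul t))
  have eq : (fun x : ℝ => (x ^ n - t) * (e * wt a b₁ 0 x - wt a b₂ 0 x)) = fun x =>
      e * (x ^ n * wt a b₁ 0 x - t * (x ^ 0 * wt a b₁ 0 x)) -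
        (x ^ n * wt a b₂ 0 x - t * (x ^ 0 * wt a b₂ 0 x)) := by
    funext x; ring
  have e1 := integral_sub i1 i2
  have e2 := integral_sub (mom_integrable hc₁ 0 n) ((mom_integrable hc₁ 0 0).const_mul t)
  have e3 := integral_sub (mom_integrable hc₂ 0 n) ((mom_integrable hc₂ 0 0).const_mul t)
  simp only [Pi.sub_apply, integral_const_mul] at e1 e2 e3
  rw [eq]
  refine ⟨i1.sub i2, ?_⟩
  rw [e1, e2, e3]
  rfl

lemma mono4 {a b₁ b₂ : ℝ} (ha : 0 < a) (hb : b₁ < b₂) :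
    mom a b₂ 0 4 * mom a b₁ 0 0 < mom a b₁ 0 4 * mom a b₂ 0 0 := by
  have hc₁ := coer_quartic ha b₁
  have hc₂ := coer_quartic ha b₂
  have z1 := mom0_pos hc₁ 0
  have h4 : 0 < mom a b₁ 0 4 := by
    refine cont_int_pos (y := 1) (by have := wt_cont a b₁ 0; fun_prop) (mom_integrable hc₁ 0 4) (fun x => ?_) ?_
    · have := (wt_pos a b₁ 0 x).le; positivity
    · have := (wt_pos a b₁ 0 1).ne'; simpa
  set T := mom a b₁ 0 4 / mom a b₁ 0 0 with hT
  have hTp : 0 < T := by positivity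
  set c := Real.sqrt T with hcdef
  have hcp : 0 < c := Real.sqrt_pos.2 hTp
  have hcT : c ^ 2 = T := Real.sq_sqrt hTp.le
  set d := b₂ - b₁ with hd
  have hdp : 0 < d := by linarith
  obtain ⟨hi, he⟩ := split4 hc₁ hc₂ 4 T (Real.exp (-(d * c)))
  have hT1 : mom a b₁ 0 4 - T * mom a b₁ 0 0 = 0 := by rw [hT]; field_simp; ring
  rw [hT1] at he
  have hpos : 0 < ∫ x, (x ^ 4 - T) * (Real.exp (-(d * c)) * wt a b₁ 0 x - wt a b₂ 0 x) := by
    refine cont_int_pos (y := 0) ?_ hi (fun x => ?_) ?_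
    · have := wt_cont a b₁ 0
      have := wt_cont a b₂ 0
      fun_prop
    · rw [wt_shift a b₁ b₂ x, ← hcT, mul_comm (Real.exp _), ← mul_sub, mul_left_comm]
      refine mul_nonneg (wt_pos _ _ _ _).le ?_
      rcases le_total (x ^ 2) c with h | h
      · have : Real.exp (-(d * c)) ≤ Real.exp (-(d * x ^ 2)) := by gcongr
        have : x ^ 4 ≤ c ^ 2 := by nlinarith [sq_nonneg x]
        rw [← hd]
        nlinarith
      · have : Real.exp (-(d * x ^ 2)) ≤ Real.exp (-(d * c)) := by gcongr
        have : c ^ 2 ≤ x ^ 4 := by nlinarith [sq_nonneg x]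
        rw [← hd]
        exact mul_nonneg (by linarith) (by linarith)
    · have : Real.exp (-(d * c)) < 1 := by
        rw [Real.exp_lt_one_iff]; nlinarith
      have h1 : wt a b₁ 0 0 = 1 := by simp [wt]
      have h2 : wt a b₂ 0 0 = 1 := by simp [wt]
      rw [h1, h2]
      refine mul_ne_zero ?_ ?_
      · norm_num; exact hTp.ne'
      · linarith
  have : mom a b₂ 0 4 < T * mom a b₂ 0 0 := by linarith
  have h5 := mul_lt_mul_of_pos_right this z1
  have h6 : T * mom a b₂ 0 0 * mom a b₁ 0 0 = mom a b₁ 0 4 * mom a b₂ 0 0 := by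
    rw [hT]; field_simp
  linarith

lemma mono2 {a b₁ b₂ : ℝ} (ha : 0 < a) (hb : b₁ ≤ b₂) :
    mom a b₂ 0 2 * mom a b₁ 0 0 ≤ mom a b₁ 0 2 * mom a b₂ 0 0 := by
  have hc₁ := coer_quartic ha b₁
  have hc₂ := coer_quartic ha b₂
  have z1 := mom0_pos hc₁ 0
  set T := mom a b₁ 0 2 / mom a b₁ 0 0 with hT
  set d := b₂ - b₁ with hd
  have hdp : 0 ≤ d := by linarith
  obtain ⟨hi, he⟩ := split4 hc₁ hc₂ 2 T (Real.exp (-(d * T)))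
  have hT1 : mom a b₁ 0 2 - T * mom a b₁ 0 0 = 0 := by rw [hT]; field_simp; ring
  rw [hT1] at he
  have hpos : 0 ≤ ∫ x, (x ^ 2 - T) * (Real.exp (-(d * T)) * wt a b₁ 0 x - wt a b₂ 0 x) := by
    refine integral_nonneg fun x => ?_
    simp only [Pi.zero_apply]
    rw [wt_shift a b₁ b₂ x, mul_comm (Real.exp _), ← mul_sub, mul_left_comm]
    refine mul_nonneg (wt_pos _ _ _ _).le ?_
    rw [← hd]
    rcases le_total (x ^ 2) T with h | h
    · have : Real.exp (-(d * T)) ≤ Real.exp (-(d * x ^ 2)) := by gcongr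
      nlinarith
    · have : Real.exp (-(d * x ^ 2)) ≤ Real.exp (-(d * T)) := by gcongr
      exact mul_nonneg (by linarith) (by linarith)
  have : mom a b₂ 0 2 ≤ T * mom a b₂ 0 0 := by linarith
  have h5 := mul_le_mul_of_nonneg_right this z1.le
  have h6 : T * mom a b₂ 0 0 * mom a b₁ 0 0 = mom a b₁ 0 2 * mom a b₂ 0 0 := by
    rw [hT]; field_simp
  linarith

lemma transversal {β s₁ s₂ : ℝ} (hβ : 0 < β) (hs₁ : 0 < s₁) (hs : s₁ < s₂)
    (h : mom (s₁ / 4) (s₁ * (β - 1) / 2) 0 2 = mom (s₁ / 4) (s₁ * (β - 1) / 2) 0 4) :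
    mom (s₂ / 4) (s₂ * (β - 1) / 2) 0 4 < mom (s₂ / 4) (s₂ * (β - 1) / 2) 0 2 := by
  have hs₂ : 0 < s₂ := hs₁.trans hs
  obtain ⟨l, hl0, hl1, hl⟩ : ∃ l : ℝ, 0 < l ∧ l < 1 ∧ l ^ 4 * s₂ = s₁ := by
    have hr : 0 < s₁ / s₂ := by positivity
    have hr1 : s₁ / s₂ < 1 := (div_lt_one hs₂).2 hs
    refine ⟨√√(s₁ / s₂), by positivity, ?_, ?_⟩
    · rw [Real.sqrt_lt' one_pos, Real.sqrt_lt' (by norm_num)]; simpa using hr1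
    · have : √√(s₁ / s₂) ^ 4 = s₁ / s₂ := by
        rw [show (4 : ℕ) = 2 * 2 from rfl, pow_mul, Real.sq_sqrt (Real.sqrt_nonneg _), Real.sq_sqrt hr.le]
      rw [this]; field_simp
  have sc := fun n => mom_scale (s₂ / 4) (s₂ * (β - 1) / 2) hl0 n
  rw [← sc 4, ← sc 2]
  have ea : l ^ 4 * (s₂ / 4) = s₁ / 4 := by rw [← hl]; ring
  rw [ea]
  have ha : 0 < s₁ / 4 := by positivity
  set a := s₁ / 4 with hadef
  set b := s₁ * (β - 1) / 2 with hb
  set B := l ^ 2 * (s₂ * (β - 1) / 2) with hB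
  have hbB : b = l ^ 2 * B := by rw [hb, hB, ← hl]; ring
  have I1 := ibp (coer_quartic ha b) 0 1
  have I2 := ibp (coer_quartic ha B) 0 1
  norm_num at I1 I2
  rw [← h] at I1
  have pZ := mom0_pos (coer_quartic ha b) 0
  have pQ := mom0_pos (coer_quartic ha B) 0
  set Z := mom a b 0 0
  set M := mom a b 0 2
  set Q := mom a B 0 0
  set Q2 := mom a B 0 2
  set Q4 := mom a B 0 4
  have hZ : Z = s₁ * β * M := by rw [hadef, hb] at I1; linarith
  have hMp : 0 < M := by
    by_contra hcon
    have : s₁ * β * M ≤ 0 := mul_nonpos_of_nonneg_of_nonpos (by positivity) (by linarith)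
    linarith
  have hl2 : l ^ 2 < 1 := by nlinarith
  have hl2p : 0 < l ^ 2 := by positivity
  have hQ : l ^ 2 * Q = s₁ * (l ^ 2 * Q4) + s₁ * (β - 1) * Q2 := by
    have : s₁ * (β - 1) = 2 * (l ^ 2 * B) := by rw [← hbB, hb]; ring
    rw [this]
    have : s₁ = 4 * a := by rw [hadef]; ring
    rw [this]
    linear_combination l ^ 2 * I2
  have key : l ^ 2 * Q * M < Q2 * Z := by
    rcases le_or_gt β 1 with hb1 | hb1
    · have hle : B ≤ b := by
        have : B ≤ 0 := by
          rw [hB]; refine mul_nonpos_of_nonneg_of_nonpos hl2p.le ?_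
          have : s₂ * (β - 1) ≤ 0 := mul_nonpos_of_nonneg_of_nonpos hs₂.le (by linarith)
          linarith
        rw [hbB]; nlinarith
      have := mono2 ha hle
      have h1 : l ^ 2 * (Q * M) < 1 * (Q * M) := by gcongr
      change M * Q ≤ Q2 * Z at this
      linarith
    · have hlt : b < B := by
        have : 0 < B := by
          rw [hB]
          have : 0 < β - 1 := by linarith
          positivity
        rw [hbB]; nlinarith
      have := mono4 ha hlt
      rw [← h] at this
      change Q4 * Z < M * Q at this
      have h1 : s₁ * l ^ 2 * (Q4 * Z) < s₁ * l ^ 2 * (M * Q) := by gcongr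
      have h2 : (s₁ * (β - 1)) * (l ^ 2 * Q * M) < (s₁ * (β - 1)) * (Q2 * Z) := by
        have e1 : s₁ * l ^ 2 * (Q4 * Z) = l ^ 2 * Q * Z - s₁ * (β - 1) * Q2 * Z := by
          rw [hQ]; ring
        have e2 : l ^ 2 * Q * Z = s₁ * β * (l ^ 2 * Q * M) := by rw [hZ]; ring
        rw [e1, e2] at h1
        linarith
      have : 0 < s₁ * (β - 1) := mul_pos hs₁ (by linarith)
      exact lt_of_mul_lt_mul_left h2 this.le
  -- conclude
  have k2 : l ^ 2 * Q < s₁ * β * Q2 := by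
    have : M * (l ^ 2 * Q) < M * (s₁ * β * Q2) := by
      rw [hZ] at key; linarith
    exact lt_of_mul_lt_mul_left this hMp.le
  have k3 : l ^ 2 * Q4 < Q2 := by
    have : s₁ * (l ^ 2 * Q4) < s₁ * Q2 := by linarith
    exact lt_of_mul_lt_mul_left this hs₁.le
  have : l ^ 3 * (l ^ 2 * Q4) < l ^ 3 * Q2 := by gcongr
  calc Q4 * l ^ (4 + 1) = l ^ 3 * (l ^ 2 * Q4) := by ring
    _ < _ := this
    _ = _ := by ring

lemma wt_h (a b h x : ℝ) : wt a b h x = Real.exp (h * x) * wt a b 0 x := by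
  unfold wt
  rw [← Real.exp_add]
  congr 1
  ring

lemma mom_cont {a b : ℝ} (hc : Coer a b) (n : ℕ) : Continuous (fun h => mom a b h n) := by
  rw [continuous_iff_continuousAt]
  intro h₀
  unfold mom
  refine continuousAt_of_dominated (bound := fun x => |x| ^ n * (Real.exp ((|h₀| + 1) * |x|) * wt a b 0 x))
    (Eventually.of_forall fun h => (mom_integrable hc h n).aestronglyMeasurable) ?_
    (dom_integrable hc _ n) (ae_of_all _ fun x => ?_)
  · have : ∀ᶠ h : ℝ in 𝓝 h₀, |h| < |h₀| + 1 :=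
      continuous_abs.continuousAt.eventually_lt continuousAt_const (by simp)
    filter_upwards [this] with h hh
    refine ae_of_all _ fun x => ?_
    rw [norm_mul, norm_pow, Real.norm_eq_abs, Real.norm_of_nonneg (wt_pos a b h x).le, wt_h]
    have := (wt_pos a b 0 x).le
    have hle : h * x ≤ (|h₀| + 1) * |x| :=
      calc h * x ≤ |h| * |x| := by rw [← abs_mul]; exact le_abs_self _
        _ ≤ _ := by gcongr
    have := Real.exp_le_exp.2 hle
    gcongr
  · unfold wt; fun_prop

lemma exp_second (y : ℝ) : |Real.exp y - 1 - y| ≤ y ^ 2 * Real.exp |y| := by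
  have := Complex.norm_exp_sub_sum_le_norm_mul_exp (y : ℂ) 2
  simp only [Finset.sum_range_succ, Finset.sum_range_zero] at this
  norm_num at this
  have e : Complex.exp y - (1 + y) = ((Real.exp y - 1 - y : ℝ) : ℂ) := by push_cast; ring
  rw [e, Complex.norm_real] at this
  simpa using this

lemma exists_field {a b : ℝ} (hc : Coer a b) (hlt : mom a b 0 4 < mom a b 0 2) :
    ∃ h > 0, mom a b h 1 = mom a b h 3 := by
  have hcont : Continuous (fun h => mom a b h 1 - mom a b h 3) := (mom_cont hc 1).sub (mom_cont hc 3)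
  have hΨ : ∀ h, mom a b h 1 - mom a b h 3 = ∫ x, (x ^ 1 * wt a b h x - x ^ 3 * wt a b h x) := fun h =>
    (integral_sub (mom_integrable hc h 1) (mom_integrable hc h 3)).symm
  have hΨi := fun h => (mom_integrable hc h 1).sub (mom_integrable hc h 3)
  -- small field
  obtain ⟨h₁, hh₁, hp⟩ : ∃ h > 0, 0 < mom a b h 1 - mom a b h 3 := by
    have j3 := dom_integrable hc 1 3
    have j5 := dom_integrable hc 1 5
    set K := ∫ x, (|x| ^ 3 * (Real.exp (1 * |x|) * wt a b 0 x) + |x| ^ 5 * (Real.exp (1 * |x|) * wt a b 0 x)) with hK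
    have hK0 : 0 ≤ K := integral_nonneg fun x => by
      have := (wt_pos a b 0 x).le
      simp only [Pi.zero_apply]; positivity
    have bd : ∀ h, 0 ≤ h → h ≤ 1 →
        h * (mom a b 0 2 - mom a b 0 4) - h ^ 2 * K ≤ mom a b h 1 - mom a b h 3 := by
      intro h hh0 hh1
      have i0 := hΨi 0
      have i1 := ((mom_integrable hc 0 2).sub (mom_integrable hc 0 4)).const_mul h
      have i2 := (j3.add j5).const_mul (h ^ 2)
      have e1 := integral_sub (i0.add i1) i2
      have e2 := integral_add i0 i1
      have e3 := integral_sub (mom_integrable hc 0 2) (mom_integrable hc 0 4)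
      have e4 := hΨ 0
      rw [mom_odd a b (by decide), mom_odd a b (by decide)] at e4
      simp only [Pi.sub_apply, Pi.add_apply, integral_const_mul] at e1 e2 e3
      rw [e2, e3, ← hK, ← e4] at e1
      have e5 : h * (mom a b 0 2 - mom a b 0 4) - h ^ 2 * K
        = 0 - 0 + h * ((∫ x, x ^ 2 * wt a b 0 x) - ∫ x, x ^ 4 * wt a b 0 x) - h ^ 2 * K := by
          unfold mom; ring
      rw [e5, ← e1, hΨ h]
      refine integral_mono ((i0.add i1).sub i2) (hΨi h) fun x => ?_
      simp only [Pi.sub_apply]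
      rw [wt_h a b h x]
      have hw := (wt_pos a b 0 x).le
      have hs := exp_second (h * x)
      have hexp : Real.exp |h * x| ≤ Real.exp (1 * |x|) := by
        rw [abs_mul, abs_of_nonneg hh0]; gcongr
      have h6 : |(x - x ^ 3) * (Real.exp (h * x) - 1 - h * x)| ≤
          (|x| + |x| ^ 3) * ((h * x) ^ 2 * Real.exp (1 * |x|)) := by
        rw [abs_mul]
        gcongr
        · calc |x - x ^ 3| ≤ |x| + |x ^ 3| := abs_sub _ _
            _ = _ := by rw [abs_pow]
        · exact hs.trans (by gcongr)
      have h7 := (abs_le.1 h6).1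
      have h8 := mul_le_mul_of_nonneg_right h7 hw
      have h9 : (h * x) ^ 2 = h ^ 2 * |x| ^ 2 := by rw [mul_pow, sq_abs]
      rw [h9] at h8
      linarith
    set g := mom a b 0 2 - mom a b 0 4 with hg
    have hgp : 0 < g := by linarith
    refine ⟨min 1 (g / (2 * (K + 1))), by positivity, ?_⟩
    set h := min 1 (g / (2 * (K + 1))) with hh
    have hp : 0 < h := by positivity
    have hle : h ≤ g / (2 * (K + 1)) := min_le_right _ _
    rw [le_div_iff₀ (by positivity)] at hle
    refine lt_of_lt_of_le ?_ (bd h hp.le (min_le_left _ _))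
    have : 0 < h * (g - h * K) := mul_pos hp (by nlinarith)
    linarith
  -- large field
  obtain ⟨h₂, hh₂, hn⟩ : ∃ h ≥ h₁, mom a b h 1 - mom a b h 3 < 0 := by
    have j1 := dom_integrable hc 0 1
    have j3 := dom_integrable hc 0 3
    have j2 := dom_integrable hc 0 2
    have j4 := dom_integrable hc 0 4
    have hki : Integrable (fun x : ℝ => (x ^ 3 - x) * max (x - 1) 0 * wt a b 0 x) := by
      refine ((j1.add j3).add (j2.add j4)).mono' ?_ (ae_of_all _ fun x => ?_)
      · refine Continuous.aestronglyMeasurable ?_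
        have := wt_cont a b 0
        fun_prop
      · rw [norm_mul, norm_mul, Real.norm_eq_abs, Real.norm_eq_abs, Real.norm_of_nonneg (wt_pos a b 0 x).le]
        have h1 : |x ^ 3 - x| ≤ |x| ^ 3 + |x| := by
          calc |x ^ 3 - x| ≤ |x ^ 3| + |x| := abs_sub _ _
            _ = _ := by rw [abs_pow]
        have h2 : |max (x - 1) 0| ≤ |x| + 1 := by
          rw [abs_of_nonneg (le_max_right _ _)]
          have := le_abs_self x
          have := abs_nonneg x
          exact max_le (by linarith) (by linarith)
        have h3 := mul_le_mul h1 h2 (abs_nonneg _) (by positivity)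
        have h4 := mul_le_mul_of_nonneg_right h3 (wt_pos a b 0 x).le
        simp only [Pi.add_apply, zero_mul, Real.exp_zero]
        linarith
    set D := ∫ x, (x ^ 3 - x) * max (x - 1) 0 * wt a b 0 x with hD
    set C := ∫ x, (|x| ^ 1 * (Real.exp (0 * |x|) * wt a b 0 x) + |x| ^ 3 * (Real.exp (0 * |x|) * wt a b 0 x)) with hC
    have hknn : ∀ x : ℝ, 0 ≤ (x ^ 3 - x) * max (x - 1) 0 := by
      intro x
      rcases le_total x 1 with h | h
      · rw [max_eq_right (by linarith)]; simp
      · exact mul_nonneg (by nlinarith [mul_nonneg (by linarith : (0:ℝ) ≤ x) (by nlinarith : (0:ℝ) ≤ x^2 - 1)]) (le_max_right _ _)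
    have hDp : 0 < D := by
      refine cont_int_pos (y := 2) ?_ hki (fun x => mul_nonneg (hknn x) (wt_pos _ _ _ _).le) ?_
      · have := wt_cont a b 0
        fun_prop
      · have := (wt_pos a b 0 2).ne'
        norm_num
        exact this
    have bd : ∀ h, 0 ≤ h → mom a b h 1 - mom a b h 3 ≤ Real.exp h * (C - h * D) := by
      intro h hh
      have i1 := ((j1.add j3).sub (hki.const_mul h)).const_mul (Real.exp h)
      have e1 := integral_sub (j1.add j3) (hki.const_mul h)
      simp only [Pi.add_apply, integral_const_mul] at e1
      rw [hΨ h, hC, hD, ← e1, ← integral_const_mul]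
      refine integral_mono (hΨi h) i1 fun x => ?_
      simp only [Pi.sub_apply]
      rw [wt_h a b h x]
      have hw := (wt_pos a b 0 x).le
      have main : (x - x ^ 3) * Real.exp (h * x) ≤
          Real.exp h * (|x| + |x| ^ 3 - h * ((x ^ 3 - x) * max (x - 1) 0)) := by
        have ee : Real.exp (h * x) = Real.exp h * Real.exp (h * (x - 1)) := by
          rw [← Real.exp_add]; congr 1; ring
        rw [ee, mul_left_comm]
        refine mul_le_mul_of_nonneg_left ?_ (Real.exp_pos _).le
        rcases le_total x 1 with hx | hx
        · rw [max_eq_right (by linarith)]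
          have h1 : Real.exp (h * (x - 1)) ≤ 1 := by
            rw [Real.exp_le_one_iff]; exact mul_nonpos_of_nonneg_of_nonpos hh (by linarith)
          have h2 : |x - x ^ 3| ≤ |x| + |x| ^ 3 := by
            calc |x - x ^ 3| ≤ |x| + |x ^ 3| := abs_sub _ _
              _ = _ := by rw [abs_pow]
          calc (x - x ^ 3) * Real.exp (h * (x - 1)) ≤ |x - x ^ 3| * 1 :=
                mul_le_mul (le_abs_self _) h1 (Real.exp_pos _).le (abs_nonneg _)
            _ ≤ _ := by linarith
        · rw [max_eq_left (by linarith)]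
          have h1 := Real.add_one_le_exp (h * (x - 1))
          have h2 : 0 ≤ x ^ 3 - x := by
            nlinarith [mul_nonneg (by linarith : (0:ℝ) ≤ x) (by nlinarith : (0:ℝ) ≤ x^2 - 1)]
          have h3 := mul_le_mul_of_nonneg_left h1 h2
          have h4 : 0 ≤ |x| + |x| ^ 3 := by positivity
          linarith
      have := mul_le_mul_of_nonneg_right main hw
      simp only [zero_mul, Real.exp_zero]
      linarith
    refine ⟨max h₁ (C / D + 1), le_max_left _ _, ?_⟩
    set h := max h₁ (C / D + 1)
    have h1 : 0 ≤ h := hh₁.le.trans (le_max_left _ _)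
    have h2 : C / D + 1 ≤ h := le_max_right _ _
    refine (bd h h1).trans_lt (mul_neg_of_pos_of_neg (Real.exp_pos _) ?_)
    have : C / D < h := by linarith
    rw [div_lt_iff₀ hDp] at this
    linarith
  obtain ⟨h, hh, hz⟩ := intermediate_value_Icc' hh₂ hcont.continuousOn (⟨hn.le, hp.le⟩ : (0:ℝ) ∈ Icc _ _)
  exact ⟨h, lt_of_lt_of_le hh₁ hh.1, by simpa [sub_eq_zero] using hz⟩

/-- Normalised measure with weight `wt a b h`. -/
def G (a b h : ℝ) : Measure ℝ :=
  (ENNReal.ofReal (mom a b h 0))⁻¹ • volume.withDensity (fun x => ENNReal.ofReal (wt a b h x))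

lemma gibbs_eq_G {a b h k : ℝ} {U : ℝ → ℝ}
    (hU : ∀ x, -(U x) = k + (-(a * x ^ 4 + b * x ^ 2) + h * x)) : gibbs U volume = G a b h := by
  have hE : ∀ x, Real.exp (-(U x)) = Real.exp k * wt a b h x := by
    intro x; rw [hU, Real.exp_add]; rfl
  have hk := Real.exp_pos k
  unfold gibbs G
  simp only [hE, integral_const_mul, ENNReal.ofReal_mul hk.le]
  have hm : Measurable (fun x => ENNReal.ofReal (wt a b h x)) :=
    (wt_cont a b h).measurable.ennreal_ofReal
  have h1 : (volume : Measure ℝ).withDensity (fun x => ENNReal.ofReal (Real.exp k) * ENNReal.ofReal (wt a b h x))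
      = ENNReal.ofReal (Real.exp k) • volume.withDensity (fun x => ENNReal.ofReal (wt a b h x)) := by
    rw [← withDensity_smul _ hm]; rfl
  have hk0 : ENNReal.ofReal (Real.exp k) ≠ 0 := by simpa using hk
  rw [h1, smul_smul]
  congr 1
  have h2 : mom a b h 0 = ∫ x, wt a b h x := by simp [mom]
  rw [← h2, ENNReal.mul_inv (Or.inl hk0) (Or.inl ENNReal.ofReal_ne_top), mul_comm, ← mul_assoc,
    ENNReal.mul_inv_cancel hk0 ENNReal.ofReal_ne_top, one_mul]

lemma G_prob {a b : ℝ} (hc : Coer a b) (h : ℝ) : IsProbabilityMeasure (G a b h) := by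
  constructor
  have hz := mom0_pos hc h
  have hi := mom_integrable hc h 0
  simp only [pow_zero, one_mul] at hi
  have h2 : mom a b h 0 = ∫ x, wt a b h x := by simp [mom]
  unfold G
  rw [Measure.smul_apply, withDensity_apply _ MeasurableSet.univ, Measure.restrict_univ, smul_eq_mul,
    ← ofReal_integral_eq_lintegral_ofReal hi (ae_of_all _ fun x => (wt_pos a b h x).le), ← h2]
  exact ENNReal.inv_mul_cancel (by simpa using hz) ENNReal.ofReal_ne_top

lemma G_integral {a b : ℝ} (hc : Coer a b) (h : ℝ) (n : ℕ) :
    Integrable (fun x : ℝ => x ^ n) (G a b h) ∧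
    ∫ x, x ^ n ∂(G a b h) = mom a b h n / mom a b h 0 := by
  have hz := mom0_pos hc h
  have hm : Measurable (fun x => ENNReal.ofReal (wt a b h x)) :=
    (wt_cont a b h).measurable.ennreal_ofReal
  have hr : ∀ x, (ENNReal.ofReal (wt a b h x)).toReal = wt a b h x := fun x =>
    ENNReal.toReal_ofReal (wt_pos a b h x).le
  unfold G
  constructor
  · refine Integrable.smul_measure ?_ (by simpa using hz)
    rw [integrable_withDensity_iff hm (ae_of_all _ fun x => ENNReal.ofReal_lt_top)]
    simp only [hr]
    exact mom_integrable hc h n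
  · rw [integral_smul_measure, integral_withDensity_eq_integral_toReal_smul hm
      (ae_of_all _ fun x => ENNReal.ofReal_lt_top)]
    simp only [hr, smul_eq_mul]
    rw [ENNReal.toReal_inv, ENNReal.toReal_ofReal hz.le]
    unfold mom
    simp only [mul_comm (wt a b h _)]
    ring

lemma nuSigma_eq (β σ : ℝ) :
    nuSigma β σ = G ((2 / σ ^ 2) / 4) ((2 / σ ^ 2) * (β - 1) / 2) 0 :=
  gibbs_eq_G (k := 0) fun x => by ring

lemma G_sol {β σ h : ℝ} (hσ : 0 < σ)
    (hh : mom ((2 / σ ^ 2) / 4) ((2 / σ ^ 2) * (β - 1) / 2) h 1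
      = mom ((2 / σ ^ 2) / 4) ((2 / σ ^ 2) * (β - 1) / 2) h 3) :
    dawsonSol β σ (G ((2 / σ ^ 2) / 4) ((2 / σ ^ 2) * (β - 1) / 2) h) := by
  have hs : 0 < 2 / σ ^ 2 := by positivity
  have e2 : β / σ ^ 2 = β * (2 / σ ^ 2) / 2 := by ring
  unfold dawsonSol
  rw [e2]
  set s := 2 / σ ^ 2
  have hc := coer_quartic (by positivity : 0 < s / 4) (s * (β - 1) / 2)
  have hp := G_prob hc h
  have hz := mom0_pos hc h
  have I := ibp hc h 0
  norm_num at I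
  rw [← hh] at I
  obtain ⟨i1, m1⟩ := G_integral hc h 1
  obtain ⟨i2, m2⟩ := G_integral hc h 2
  set a := s / 4 with ha
  set b := s * (β - 1) / 2 with hb
  set ν := G a b h with hν
  set m := mom a b h 1 / mom a b h 0 with hm
  set q := mom a b h 2 / mom a b h 0
  have hmh : β * s * m = h := by
    rw [hm, ← mul_div_assoc, div_eq_iff hz.ne']
    rw [ha, hb] at I
    rw [ha, hb]
    linarith
  have hint : ∀ x : ℝ, ∫ z, (x - z) ^ 2 ∂ν = x ^ 2 - 2 * x * m + q := by
    intro x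
    have e : (fun z : ℝ => (x - z) ^ 2) = fun z => x ^ 2 - 2 * x * z ^ 1 + z ^ 2 := by funext z; ring
    rw [e]
    have j1 := (integrable_const (x ^ 2) : Integrable (fun _ : ℝ => x ^ 2) ν)
    have j2 := i1.const_mul (2 * x)
    have f1 := integral_add (j1.sub j2) i2
    have f2 := integral_sub j1 j2
    simp only [Pi.sub_apply, integral_const_mul] at f1 f2
    rw [f1, f2, m1, m2]
    simp
  refine ⟨hp, i2, ?_⟩
  symm
  apply gibbs_eq_G (k := -(β * s / 2 * q))
  intro x
  rw [hint x, ← hmh, ha, hb]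
  ring

/-- `ν_σ` solves the Dawson equation, and a critical `σ0` is a
bifurcation point. -/
theorem dawson_bifurcation (β : ℝ) (hβ : 0 < β) :
    (∀ σ : ℝ, 0 < σ → dawsonSol β σ (nuSigma β σ)) ∧
    (∀ σ0 : ℝ, 0 < σ0 →
      (1 : ℝ) = (2 * β / σ0 ^ 2) * ∫ x, x ^ 2 ∂(nuSigma β σ0) →
      σ0 ∈ Icc (Real.sqrt (2 * β / 3)) (Real.sqrt (2 * β)) ∧
      ∀ δ' : ℝ, 0 < δ' → ∃ σ : ℝ, σ ∈ Ioo (σ0 - δ') (σ0 + δ') ∧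
        ∃ μσ : Measure ℝ, dawsonSol β σ μσ ∧ μσ ≠ nuSigma β σ) := by
  have hnu : ∀ σ : ℝ, 0 < σ → dawsonSol β σ (nuSigma β σ) := by
    intro σ hσ
    rw [nuSigma_eq]
    exact G_sol hσ (by rw [mom_odd _ _ (by decide), mom_odd _ _ (by decide)])
  refine ⟨hnu, fun σ0 hσ0 hcrit => ?_⟩
  have hs : 0 < 2 / σ0 ^ 2 := by positivity
  have hc := coer_quartic (by positivity : 0 < (2 / σ0 ^ 2) / 4) ((2 / σ0 ^ 2) * (β - 1) / 2)
  have hz := mom0_pos hc 0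
  have I := ibp hc 0 1
  have hup := upper hc
  have hlo := lower (b := (2 / σ0 ^ 2) * (β - 1) / 2) (by positivity : 0 < (2 / σ0 ^ 2) / 4)
  norm_num at I
  rw [nuSigma_eq, (G_integral hc 0 2).2] at hcrit
  have hcrit' : mom ((2 / σ0 ^ 2) / 4) ((2 / σ0 ^ 2) * (β - 1) / 2) 0 0
      = β * (2 / σ0 ^ 2) * mom ((2 / σ0 ^ 2) / 4) ((2 / σ0 ^ 2) * (β - 1) / 2) 0 2 := by
    rw [← mul_div_assoc, eq_div_iff hz.ne'] at hcrit
    rw [one_mul] at hcrit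
    rw [hcrit]; ring
  have heq : mom ((2 / σ0 ^ 2) / 4) ((2 / σ0 ^ 2) * (β - 1) / 2) 0 2
      = mom ((2 / σ0 ^ 2) / 4) ((2 / σ0 ^ 2) * (β - 1) / 2) 0 4 := by
    have : 2 / σ0 ^ 2 * mom ((2 / σ0 ^ 2) / 4) ((2 / σ0 ^ 2) * (β - 1) / 2) 0 2
      = 2 / σ0 ^ 2 * mom ((2 / σ0 ^ 2) / 4) ((2 / σ0 ^ 2) * (β - 1) / 2) 0 4 := by
      rw [hcrit'] at I
      linarith
    exact mul_left_cancel₀ hs.ne' this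
  refine ⟨?_, fun δ' hδ => ?_⟩
  · rw [← heq] at hup hlo
    set A := mom ((2 / σ0 ^ 2) / 4) ((2 / σ0 ^ 2) * (β - 1) / 2) 0 2
    set Z := mom ((2 / σ0 ^ 2) / 4) ((2 / σ0 ^ 2) * (β - 1) / 2) 0 0
    have hA : 0 < A := by
      by_contra hcon
      have : β * (2 / σ0 ^ 2) * A ≤ 0 := mul_nonpos_of_nonneg_of_nonpos (by positivity) (by linarith)
      linarith
    have hσZ : σ0 ^ 2 * Z = 2 * β * A := by rw [hcrit']; field_simp
    have hAZ : A ≤ Z := by nlinarith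
    have hZA : Z ≤ 3 * A := by nlinarith
    constructor
    · apply Real.sqrt_le_iff.2 ⟨hσ0.le, ?_⟩
      have : 2 * β / 3 * Z ≤ σ0 ^ 2 * Z := by rw [hσZ]; nlinarith
      exact le_of_mul_le_mul_right this hz
    · apply Real.le_sqrt_of_sq_le
      have : σ0 ^ 2 * Z ≤ 2 * β * Z := by rw [hσZ]; gcongr
      exact le_of_mul_le_mul_right this hz
  · obtain ⟨σ, hσ, hlt, hd⟩ : ∃ σ : ℝ, 0 < σ ∧ σ < σ0 ∧ σ0 - δ' < σ :=
      ⟨max (σ0 / 2) (σ0 - δ' / 2), lt_max_of_lt_left (by linarith), max_lt (by linarith) (by linarith),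
        lt_max_of_lt_right (by linarith)⟩
    refine ⟨σ, ⟨hd, by linarith⟩, ?_⟩
    have hss : 2 / σ0 ^ 2 < 2 / σ ^ 2 := by gcongr
    have ht := transversal hβ hs hss heq
    have hc' := coer_quartic (by positivity : 0 < (2 / σ ^ 2) / 4) ((2 / σ ^ 2) * (β - 1) / 2)
    obtain ⟨h, hh, hsol⟩ := exists_field hc' ht
    refine ⟨_, G_sol hσ hsol, fun hcon => ?_⟩
    rw [nuSigma_eq] at hcon
    have h1 := (G_integral hc' h 1).2
    rw [hcon, (G_integral hc' 0 1).2, mom_odd _ _ (by decide), zero_div] at h1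
    have hz' := mom0_pos hc' h
    have hm : mom ((2 / σ ^ 2) / 4) ((2 / σ ^ 2) * (β - 1) / 2) h 1 = 0 := by
      rcases div_eq_zero_iff.1 h1.symm with h | h
      · exact h
      · exact absurd h hz'.ne'
    have I' := ibp hc' h 0
    norm_num at I'
    rw [← hsol, hm] at I'
    have := mul_pos hh hz'
    linarith

end PME
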